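/- Proposition (Poisson property for the super ambitwistor case ℒ^{5|6}): On the supercommutative algebra A = ℂ[X¹, X², λ₁, λ₂, Y^1̇, Y^2̇, μ₁, μ₂] ⊗ Λ(ξ₁, ξ₂, ξ₃, ζ¹, ζ², ζ³), the superbivector π = λ₁λ₂ ∂/∂X¹ ∧ ∂/∂X² + ½λ₂μ₂ ∂/∂X¹ ∧ ∂/∂Y^1̇ + ½λ₁μ₂ ∂/∂X¹ ∧ ∂/∂Y^2̇ − ½λ₂μ₁ ∂/∂X² ∧ ∂/∂Y^1̇ − ½λ₁μ₁ ∂/∂X² ∧ ∂/∂Y^2̇ + ½(λ₁² + λ₂²) Σᵢ₌₁³ ∂/∂ξᵢ ∨ ∂/∂ξᵢ + ½(μ₁² + μ₂²) Σᵢ₌₁³ ∂/∂ζⁱ ∨ ∂/∂ζⁱ determines an even super Poisson bracket: even, super antisymmetric, super Leibniz, and satisfying the super Jacobi identity. -/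

import Mathlib

/-!
Super ambitwistor case `ℒ^{5|6}`: the superbivector
`π = λ₁λ₂ ∂_{X¹} ∧ ∂_{X²} + ½λ₂μ₂ ∂_{X¹} ∧ ∂_{Y^1̇} + ½λ₁μ₂ ∂_{X¹} ∧ ∂_{Y^2̇}
     − ½λ₂μ₁ ∂_{X²} ∧ ∂_{Y^1̇} − ½λ₁μ₁ ∂_{X²} ∧ ∂_{Y^2̇}
     + ½(λ₁² + λ₂²) Σ ∂_{ξᵢ} ∨ ∂_{ξᵢ} + ½(μ₁² + μ₂²) Σ ∂_{ζⁱ} ∨ ∂_{ζⁱ}`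
on `A = ℂ[X¹, X², λ₁, λ₂, Y^1̇, Y^2̇, μ₁, μ₂] ⊗ Λ(ξ₁, ξ₂, ξ₃, ζ¹, ζ², ζ³)` determines an
even super Poisson bracket.
-/

open scoped TensorProduct

noncomputable section

/-- The supercommutative algebra
`A = ℂ[X¹, X², λ₁, λ₂, Y^1̇, Y^2̇, μ₁, μ₂] ⊗ Λ(ξ₁, ξ₂, ξ₃, ζ¹, ζ², ζ³)`. -/
abbrev LAlg :=
  MvPolynomial ((Fin 2 ⊕ Fin 2) ⊕ (Fin 2 ⊕ Fin 2)) ℂ ⊗[ℂ]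
    ExteriorAlgebra ℂ (Fin 3 ⊕ Fin 3 → ℂ)

/-- The even generator `X^α`. -/
def Xv (α : Fin 2) : LAlg := MvPolynomial.X (Sum.inl (Sum.inl α)) ⊗ₜ 1

/-- The even generator `λ_α̇`. -/
def lam (α : Fin 2) : LAlg := MvPolynomial.X (Sum.inl (Sum.inr α)) ⊗ₜ 1

/-- The even generator `Y^α̇`. -/
def Yv (α : Fin 2) : LAlg := MvPolynomial.X (Sum.inr (Sum.inl α)) ⊗ₜ 1

/-- The even generator `μ_α`. -/
def mu (α : Fin 2) : LAlg := MvPolynomial.X (Sum.inr (Sum.inr α)) ⊗ₜ 1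

/-- The odd generator `ξᵢ`. -/
def xi (i : Fin 3) : LAlg := 1 ⊗ₜ ExteriorAlgebra.ι ℂ (Pi.single (Sum.inl i) 1)

/-- The odd generator `ζⁱ`. -/
def zeta (i : Fin 3) : LAlg := 1 ⊗ₜ ExteriorAlgebra.ι ℂ (Pi.single (Sum.inr i) 1)

/-- The even derivation `∂/∂X^α`. -/
def DX (α : Fin 2) : LAlg →ₗ[ℂ] LAlg :=
  TensorProduct.map (MvPolynomial.pderiv (Sum.inl (Sum.inl α))).toLinearMap LinearMap.id

/-- The even derivation `∂/∂Y^α̇`. -/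
def DY (α : Fin 2) : LAlg →ₗ[ℂ] LAlg :=
  TensorProduct.map (MvPolynomial.pderiv (Sum.inr (Sum.inl α))).toLinearMap LinearMap.id

/-- The (left) odd derivation `∂/∂ξᵢ`. -/
def Dxi (i : Fin 3) : LAlg →ₗ[ℂ] LAlg :=
  TensorProduct.map LinearMap.id (CliffordAlgebra.contractLeft (LinearMap.proj (Sum.inl i)))

/-- The (left) odd derivation `∂/∂ζⁱ`. -/
def Dzeta (i : Fin 3) : LAlg →ₗ[ℂ] LAlg :=
  TensorProduct.map LinearMap.id (CliffordAlgebra.contractLeft (LinearMap.proj (Sum.inr i)))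

/-- The grade involution of `A`. -/
def alphaA : LAlg →ₗ[ℂ] LAlg :=
  TensorProduct.map LinearMap.id (CliffordAlgebra.involute (Q := 0)).toLinearMap

/-- `f` is homogeneous of Grassmann parity `p`. -/
def IsHomog (p : ZMod 2) (f : LAlg) : Prop :=
  alphaA f = if p = 0 then f else -f

/-- The sign `(-1)^p` for `p : ZMod 2`. -/
def sgn (p : ZMod 2) : ℂ := if p = 0 then 1 else -1

/-- `λ₁λ₂`. -/
def lamlam : LAlg := lam 0 * lam 1

/-- `λ₁² + λ₂²`. -/
def lamSq : LAlg := lam 0 * lam 0 + lam 1 * lam 1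

/-- `μ₁² + μ₂²`. -/
def muSq : LAlg := mu 0 * mu 0 + mu 1 * mu 1

/-- The bracket determined by the superbivector `π` of the `ℒ^{5|6}` case on elements
`f` of parity `p`, with Koszul signs. -/
def br (p : ZMod 2) (f g : LAlg) : LAlg :=
  lamlam * (DX 0 f * DX 1 g - DX 1 f * DX 0 g) +
    (1 / 2 : ℂ) • (lam 1 * mu 1 * (DX 0 f * DY 0 g - DY 0 f * DX 0 g)) +
    (1 / 2 : ℂ) • (lam 0 * mu 1 * (DX 0 f * DY 1 g - DY 1 f * DX 0 g)) -
    (1 / 2 : ℂ) • (lam 1 * mu 0 * (DX 1 f * DY 0 g - DY 0 f * DX 1 g)) -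
    (1 / 2 : ℂ) • (lam 0 * mu 0 * (DX 1 f * DY 1 g - DY 1 f * DX 1 g)) +
    sgn p • (lamSq * ∑ i : Fin 3, Dxi i f * Dxi i g +
      muSq * ∑ i : Fin 3, Dzeta i f * Dzeta i g)

lemma ZMod.two_eq_zero_or_one (p : ZMod 2) : p = 0 ∨ p = 1 := by
  revert p
  decide

lemma sgn_zero : sgn 0 = 1 := by simp [sgn]

lemma sgn_one : sgn 1 = -1 := by simp [sgn]

lemma sgn_add (p q : ZMod 2) : sgn (p + q) = sgn p * sgn q := by
  obtain rfl | rfl := p.two_eq_zero_or_one <;> obtain rfl | rfl := q.two_eq_zero_or_one <;>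
    simp [sgn_zero, sgn_one, CharTwo.add_self_eq_zero]

lemma LAlg.neg_one_smul (f : LAlg) : (-1 : ℂ) • f = -f := _root_.neg_one_smul ℂ f

lemma isHomog_iff {p : ZMod 2} {f : LAlg} : IsHomog p f ↔ alphaA f = sgn p • f := by
  obtain rfl | rfl := p.two_eq_zero_or_one
  · rw [IsHomog, if_pos rfl, sgn_zero, one_smul]
  · rw [IsHomog, if_neg one_ne_zero, sgn_one, LAlg.neg_one_smul]

lemma alphaA_mul (f g : LAlg) : alphaA (f * g) = alphaA f * alphaA g :=
  map_mul (Algebra.TensorProduct.map (AlgHom.id ℂ _) (CliffordAlgebra.involute (Q := 0))) f g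

lemma alphaA_tmul (x : MvPolynomial ((Fin 2 ⊕ Fin 2) ⊕ (Fin 2 ⊕ Fin 2)) ℂ)
    (u : ExteriorAlgebra ℂ (Fin 3 ⊕ Fin 3 → ℂ)) :
    alphaA (x ⊗ₜ u) = x ⊗ₜ CliffordAlgebra.involute u := rfl

namespace IsHomog

variable {p q : ZMod 2} {f g : LAlg}

lemma mul (hf : IsHomog p f) (hg : IsHomog q g) : IsHomog (p + q) (f * g) := by
  rw [isHomog_iff] at *
  rw [alphaA_mul, hf, hg, smul_mul_smul_comm, sgn_add]

lemma smul (c : ℂ) (hf : IsHomog p f) : IsHomog p (c • f) := by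
  rw [isHomog_iff] at *
  rw [map_smul, hf, smul_comm]

lemma zero : IsHomog p 0 := isHomog_iff.2 ((map_zero _).trans (smul_zero _).symm)

lemma add (hf : IsHomog p f) (hg : IsHomog p g) : IsHomog p (f + g) := by
  rw [isHomog_iff] at *
  rw [map_add, hf, hg, smul_add]

end IsHomog

/-- An odd vector anticommutes with odd elements and commutes with even ones. -/
lemma ι_mul_eq_involute_mul (v : Fin 3 ⊕ Fin 3 → ℂ) (x : ExteriorAlgebra ℂ (Fin 3 ⊕ Fin 3 → ℂ)) :
    ExteriorAlgebra.ι ℂ v * x = CliffordAlgebra.involute x * ExteriorAlgebra.ι ℂ v := by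
  induction x using ExteriorAlgebra.induction with
  | algebraMap r => rw [AlgHom.commutes, Algebra.commutes]
  | ι w =>
    rw [ExteriorAlgebra.ι, CliffordAlgebra.involute_ι, neg_mul]
    exact eq_neg_of_add_eq_zero_left (ExteriorAlgebra.ι_add_mul_swap v w)
  | mul a b ha hb => rw [map_mul, ← mul_assoc, ha, mul_assoc, hb, mul_assoc]
  | add a b ha hb => rw [map_add, mul_add, add_mul, ha, hb]

lemma one_tmul_ι_mul (v : Fin 3 ⊕ Fin 3 → ℂ) (f : LAlg) :
    (1 ⊗ₜ ExteriorAlgebra.ι ℂ v : LAlg) * f = alphaA f * (1 ⊗ₜ ExteriorAlgebra.ι ℂ v) := by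
  induction f using TensorProduct.induction_on with
  | zero => simp
  | tmul x u => simp [alphaA_tmul, ι_mul_eq_involute_mul]
  | add a b ha hb => rw [map_add, mul_add, add_mul, ha, hb]

lemma tmul_one_commute (x : MvPolynomial ((Fin 2 ⊕ Fin 2) ⊕ (Fin 2 ⊕ Fin 2)) ℂ) (f : LAlg) :
    (x ⊗ₜ 1 : LAlg) * f = f * (x ⊗ₜ 1) := by
  induction f using TensorProduct.induction_on with
  | zero => simp
  | tmul y u => simp [mul_comm]
  | add a b ha hb => rw [mul_add, add_mul, ha, hb]

/-- Left and right multiplication by a homogeneous element of `A` differ by a power of the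
grade involution. -/
lemma mul_isHomog {q : ZMod 2} {g : LAlg} (hg : IsHomog q g) (f : LAlg) :
    f * g = g * (if q = 0 then f else alphaA f) := by
  have key (u : ExteriorAlgebra ℂ (Fin 3 ⊕ Fin 3 → ℂ)) : ((1 ⊗ₜ u : LAlg)) * g =
      g * (if q = 0 then 1 ⊗ₜ u else alphaA (1 ⊗ₜ u)) := by
    induction u using ExteriorAlgebra.induction with
    | algebraMap r =>
      rw [alphaA_tmul, AlgHom.commutes, ite_self, Algebra.algebraMap_eq_smul_one,
        TensorProduct.tmul_smul, smul_mul_assoc, mul_smul_comm, tmul_one_commute]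
    | ι w =>
      rw [one_tmul_ι_mul, isHomog_iff.1 hg, alphaA_tmul, ExteriorAlgebra.ι,
        CliffordAlgebra.involute_ι, TensorProduct.tmul_neg]
      obtain rfl | rfl := q.two_eq_zero_or_one
      · rw [if_pos rfl, sgn_zero, one_smul]
      · rw [if_neg one_ne_zero, sgn_one, LAlg.neg_one_smul]
        exact (neg_mul g _).trans (mul_neg g _).symm
    | mul a b ha hb =>
      have h : (1 ⊗ₜ (a * b) : LAlg) = (1 ⊗ₜ a) * (1 ⊗ₜ b) := by simp
      rw [h, mul_assoc, hb, ← mul_assoc, ha, mul_assoc, alphaA_mul]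
      split_ifs <;> rfl
    | add a b ha hb =>
      rw [TensorProduct.tmul_add, add_mul, ha, hb, map_add]
      split_ifs <;> rw [mul_add]
  induction f using TensorProduct.induction_on with
  | zero => simp
  | tmul x u =>
    have h : (x ⊗ₜ u : LAlg) = (x ⊗ₜ 1) * (1 ⊗ₜ u) := by simp
    rw [h, mul_assoc, key, ← mul_assoc, tmul_one_commute, mul_assoc, alphaA_mul, alphaA_tmul x,
      map_one]
    split_ifs <;> rfl
  | add a b ha hb =>
    rw [add_mul, ha, hb, map_add]
    split_ifs <;> rw [mul_add]

/-- Homogeneous elements of `A` supercommute. -/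
lemma IsHomog.mul_comm {p q : ZMod 2} {f g : LAlg} (hf : IsHomog p f) (hg : IsHomog q g) :
    f * g = sgn (p * q) • (g * f) := by
  rw [mul_isHomog hg, isHomog_iff.1 hf]
  obtain rfl | rfl := q.two_eq_zero_or_one
  · rw [if_pos rfl, mul_zero, sgn_zero, one_smul]
  · rw [if_neg one_ne_zero, mul_one, mul_smul_comm]

lemma contractLeft_mul (d : Module.Dual ℂ (Fin 3 ⊕ Fin 3 → ℂ))
    (x y : ExteriorAlgebra ℂ (Fin 3 ⊕ Fin 3 → ℂ)) :
    CliffordAlgebra.contractLeft d (x * y) = CliffordAlgebra.contractLeft d x * y +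
      CliffordAlgebra.involute x * CliffordAlgebra.contractLeft d y := by
  induction x using CliffordAlgebra.left_induction generalizing y with
  | algebraMap r =>
    rw [CliffordAlgebra.contractLeft_algebraMap_mul, CliffordAlgebra.contractLeft_algebraMap,
      AlgHom.commutes, zero_mul, zero_add]
  | add a b ha hb => simp only [add_mul, map_add, ha, hb]; abel
  | ι_mul a v ha =>
    rw [mul_assoc, CliffordAlgebra.contractLeft_ι_mul, ha, CliffordAlgebra.contractLeft_ι_mul,
      map_mul, CliffordAlgebra.involute_ι]
    simp only [sub_mul, mul_add, smul_mul_assoc, neg_mul, mul_assoc]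
    abel

lemma involute_contractLeft (d : Module.Dual ℂ (Fin 3 ⊕ Fin 3 → ℂ))
    (x : ExteriorAlgebra ℂ (Fin 3 ⊕ Fin 3 → ℂ)) :
    CliffordAlgebra.involute (CliffordAlgebra.contractLeft d x) =
      -CliffordAlgebra.contractLeft d (CliffordAlgebra.involute x) := by
  induction x using CliffordAlgebra.left_induction with
  | algebraMap r =>
    simp only [CliffordAlgebra.contractLeft_algebraMap, AlgHom.commutes, map_zero, neg_zero]
  | add a b ha hb => simp only [map_add, ha, hb]; abel
  | ι_mul a v ha =>
    simp only [CliffordAlgebra.contractLeft_ι_mul, map_mul, CliffordAlgebra.involute_ι, map_sub,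
      map_smul, ha, neg_mul, map_neg]
    simp

/-- Superderivations `D a` of parity `ε a` on a supercommutative algebra, pairwise
supercommuting, together with coefficients `π a b` of an even superbivector that are annihilated
by all the `D a`. -/
structure SuperbivectorData (A I : Type*) [Ring A] [Algebra ℂ A] where
  homog : ZMod 2 → Submodule ℂ A
  mul_mem : ∀ {p q f g}, f ∈ homog p → g ∈ homog q → f * g ∈ homog (p + q)
  mul_comm : ∀ {p q f g}, f ∈ homog p → g ∈ homog q → f * g = sgn (p * q) • (g * f)
  ε : I → ZMod 2
  D : I → A →ₗ[ℂ] A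
  D_mem : ∀ a {p f}, f ∈ homog p → D a f ∈ homog (p + ε a)
  D_mul : ∀ a {p f} g, f ∈ homog p → D a (f * g) = D a f * g + sgn (ε a * p) • (f * D a g)
  D_comm : ∀ a b f, D a (D b f) = sgn (ε a * ε b) • D b (D a f)
  π : I → I → A
  π_mem : ∀ a b, π a b ∈ homog 0
  D_π : ∀ c a b, D c (π a b) = 0
  π_swap : ∀ a b, π a b = -(sgn (ε a) • π b a)
  π_eq_zero : ∀ a b, ε a ≠ ε b → π a b = 0

namespace SuperbivectorData

variable {A I : Type*} [Ring A] [Algebra ℂ A] (S : SuperbivectorData A I)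
  {p q r : ZMod 2} {f g h : A}

lemma D_π_mul (c a b : I) (f : A) : S.D c (S.π a b * f) = S.π a b * S.D c f := by
  rw [S.D_mul c f (S.π_mem a b), S.D_π, mul_zero, sgn_zero, one_smul, zero_mul, zero_add]

lemma π_mul_comm (a b : I) (hf : f ∈ S.homog p) : S.π a b * f = f * S.π a b := by
  rw [S.mul_comm (S.π_mem a b) hf, zero_mul, sgn_zero, one_smul]

variable [Fintype I]

/-- The bracket determined by the superbivector, on elements `f` of parity `p`. -/
def bracket (p : ZMod 2) (f g : A) : A :=
  ∑ a, ∑ b, sgn (S.ε a * p) • (S.π a b * (S.D a f * S.D b g))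

lemma bracket_mem (hf : f ∈ S.homog p) (hg : g ∈ S.homog q) :
    S.bracket p f g ∈ S.homog (p + q) := by
  refine Submodule.sum_mem _ fun a _ => Submodule.sum_mem _ fun b _ => Submodule.smul_mem _ _ ?_
  by_cases hab : S.ε a = S.ε b
  · have := S.mul_mem (S.π_mem a b) (S.mul_mem (S.D_mem a hf) (S.D_mem b hg))
    rwa [hab, zero_add, add_add_add_comm, CharTwo.add_self_eq_zero, add_zero] at this
  · rw [S.π_eq_zero a b hab, zero_mul]
    exact Submodule.zero_mem _

lemma bracket_swap (hf : f ∈ S.homog p) (hg : g ∈ S.homog q) :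
    S.bracket p f g = -sgn (p * q) • S.bracket q g f := by
  rw [bracket, bracket, Finset.sum_comm, Finset.smul_sum]
  refine Finset.sum_congr rfl fun b _ => ?_
  rw [Finset.smul_sum]
  refine Finset.sum_congr rfl fun a _ => ?_
  by_cases hab : S.ε a = S.ε b
  · rw [S.π_swap a b, S.mul_comm (S.D_mem a hf) (S.D_mem b hg), hab]
    simp only [neg_mul, smul_mul_assoc, mul_smul_comm, smul_neg, smul_smul, ← sgn_add, neg_smul]
    congr 3
    generalize S.ε b = e
    clear * -
    revert p q e
    decide
  · rw [S.π_eq_zero a b hab, S.π_eq_zero b a (Ne.symm hab)]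
    simp

lemma bracket_mul (hf : f ∈ S.homog p) (hg : g ∈ S.homog q) (h : A) :
    S.bracket p f (g * h) = S.bracket p f g * h + sgn (p * q) • (g * S.bracket p f h) := by
  simp only [bracket, Finset.sum_mul, Finset.mul_sum, Finset.smul_sum, ← Finset.sum_add_distrib]
  refine Finset.sum_congr rfl fun a _ => Finset.sum_congr rfl fun b _ => ?_
  by_cases hab : S.ε a = S.ε b
  · have hc : S.D a f * (g * S.D b h) = sgn ((p + S.ε a) * q) • (g * (S.D a f * S.D b h)) := by
      rw [← mul_assoc, S.mul_comm (S.D_mem a hf) hg, smul_mul_assoc, mul_assoc]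
    have hπ (x : A) : g * (S.π a b * x) = S.π a b * (g * x) := by
      rw [← mul_assoc, ← S.π_mul_comm a b hg, mul_assoc]
    rw [S.D_mul b h hg, mul_add, mul_smul_comm, hc]
    simp only [mul_add, smul_add, mul_smul_comm, smul_mul_assoc, smul_smul, hπ, ← sgn_add,
      ← mul_assoc]
    congr 3
    rw [hab]
    generalize S.ε b = e
    clear * -
    revert p q e
    decide
  · simp [S.π_eq_zero a b hab]

/-- The part of `{f, {g, h}}` in which `g` is differentiated twice. -/
def doubleBracket (p q : ZMod 2) (f g h : A) : A :=
  ∑ a, ∑ b, ∑ c, ∑ d, sgn (S.ε a * p + S.ε c * q) •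
    (S.π a b * (S.π c d * (S.D a f * (S.D b (S.D c g) * S.D d h))))

lemma bracket_bracket (hf : f ∈ S.homog p) (hg : g ∈ S.homog q) (hh : h ∈ S.homog r) :
    S.bracket p f (S.bracket q g h) =
      S.doubleBracket p q f g h - sgn (q * r) • S.doubleBracket p r f h g := by
  rw [bracket, doubleBracket, doubleBracket, Finset.smul_sum, ← Finset.sum_sub_distrib]
  refine Finset.sum_congr rfl fun a _ => ?_
  rw [Finset.smul_sum, ← Finset.sum_sub_distrib]
  refine Finset.sum_congr rfl fun b _ => ?_
  rw [Finset.sum_comm (f := fun c d => sgn (S.ε a * p + S.ε c * r) •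
    (S.π a b * (S.π c d * (S.D a f * (S.D b (S.D c h) * S.D d g)))))]
  simp only [bracket, map_sum, map_smul, D_π_mul, Finset.mul_sum, Finset.smul_sum,
    ← Finset.sum_sub_distrib]
  refine Finset.sum_congr rfl fun c _ => Finset.sum_congr rfl fun d _ => ?_
  by_cases hcd : S.ε c = S.ε d
  · have hπ (x : A) : S.D a f * (S.π c d * x) = S.π c d * (S.D a f * x) := by
      rw [← mul_assoc, ← S.π_mul_comm c d (S.D_mem a hf), mul_assoc]
    rw [S.D_mul b _ (S.D_mem c hg),
      S.mul_comm (S.D_mem c hg) (S.D_mem b (S.D_mem d hh)), S.π_swap d c]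
    simp only [mul_add, smul_add, mul_smul_comm, smul_mul_assoc, smul_smul, hπ, ← sgn_add,
      neg_mul, mul_neg, smul_neg, sub_neg_eq_add, ← hcd]
    congr 3
    generalize S.ε c = e
    generalize S.ε a = e₁
    generalize S.ε b = e₂
    clear * -
    revert p q r e e₁ e₂
    decide
  · rw [S.π_eq_zero c d hcd, S.π_eq_zero d c (Ne.symm hcd)]
    simp

lemma sum_reverse {M : Type*} [AddCommMonoid M] (F : I → I → I → I → M) :
    ∑ a, ∑ b, ∑ c, ∑ d, F a b c d = ∑ d, ∑ c, ∑ b, ∑ a, F a b c d := by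
  have h (G : I → I → I → M) : ∑ a, ∑ b, ∑ c, G a b c = ∑ c, ∑ b, ∑ a, G a b c := by
    rw [Finset.sum_comm, Finset.sum_comm_cycle, Finset.sum_comm]
  calc _ = ∑ a, ∑ d, ∑ c, ∑ b, F a b c d := Finset.sum_congr rfl fun a _ => h _
    _ = ∑ d, ∑ a, ∑ c, ∑ b, F a b c d := Finset.sum_comm
    _ = ∑ d, ∑ c, ∑ b, ∑ a, F a b c d := Finset.sum_congr rfl fun d _ => by
      rw [Finset.sum_comm]
      exact Finset.sum_congr rfl fun c _ => Finset.sum_comm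

lemma doubleBracket_swap (hf : f ∈ S.homog p) (hg : g ∈ S.homog q) (hh : h ∈ S.homog r) :
    S.doubleBracket p q f g h =
      sgn (p * q + q * r + p * r) • S.doubleBracket r q h g f := by
  simp only [doubleBracket, Finset.smul_sum]
  rw [sum_reverse]
  refine Finset.sum_congr rfl fun d _ => Finset.sum_congr rfl fun c _ =>
    Finset.sum_congr rfl fun b _ => Finset.sum_congr rfl fun a _ => ?_
  by_cases hab : S.ε a = S.ε b
  · by_cases hcd : S.ε c = S.ε d
    · have hD := S.D_mem b (S.D_mem c hg)
      rw [S.mul_comm (S.D_mem a hf) (S.mul_mem hD (S.D_mem d hh)),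
        S.mul_comm hD (S.D_mem d hh), S.D_comm b c, S.π_swap a b, S.π_swap c d,
        ← mul_assoc (S.π d c), ← S.π_mul_comm b a (S.π_mem d c)]
      simp only [mul_smul_comm, smul_mul_assoc, smul_smul, ← sgn_add, neg_mul, mul_neg, neg_neg,
        smul_neg, hab, hcd, mul_assoc]
      congr 2
      generalize S.ε b = e₁
      generalize S.ε d = e₂
      clear * -
      revert p q r e₁ e₂
      decide
    · rw [S.π_eq_zero c d hcd, S.π_eq_zero d c (Ne.symm hcd)]
      simp
  · rw [S.π_eq_zero a b hab, S.π_eq_zero b a (Ne.symm hab)]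
    simp

lemma bracket_jacobi (hf : f ∈ S.homog p) (hg : g ∈ S.homog q) (hh : h ∈ S.homog r) :
    sgn (p * r) • S.bracket p f (S.bracket q g h) + sgn (q * p) • S.bracket q g (S.bracket r h f) +
      sgn (r * q) • S.bracket r h (S.bracket p f g) = 0 := by
  rw [S.bracket_bracket hf hg hh, S.bracket_bracket hg hh hf, S.bracket_bracket hh hf hg,
    S.doubleBracket_swap hf hg hh, S.doubleBracket_swap hf hh hg, S.doubleBracket_swap hg hf hh]
  obtain rfl | rfl := p.two_eq_zero_or_one <;> obtain rfl | rfl := q.two_eq_zero_or_one <;>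
    obtain rfl | rfl := r.two_eq_zero_or_one <;>
    simp only [mul_zero, mul_one, add_zero, zero_add, CharTwo.add_self_eq_zero,
      sgn_zero, sgn_one] <;> module

end SuperbivectorData
lemma MvPolynomial.pderiv_pderiv_comm {σ R : Type*} [CommRing R] (i j : σ)
    (x : MvPolynomial σ R) :
    MvPolynomial.pderiv i (MvPolynomial.pderiv j x) =
      MvPolynomial.pderiv j (MvPolynomial.pderiv i x) := by
  classical
  have h : ⁅MvPolynomial.pderiv (R := R) i, MvPolynomial.pderiv j⁆ = 0 :=
    MvPolynomial.derivation_ext fun k => by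
      rw [Derivation.commutator_apply, MvPolynomial.pderiv_X, MvPolynomial.pderiv_X]
      simp [Pi.single_apply, apply_ite]
  rw [← sub_eq_zero, ← Derivation.commutator_apply, h, Derivation.zero_apply]

/-- The even derivation of `A` along a polynomial generator. -/
def evenDeriv (i : (Fin 2 ⊕ Fin 2) ⊕ (Fin 2 ⊕ Fin 2)) : LAlg →ₗ[ℂ] LAlg :=
  TensorProduct.map (MvPolynomial.pderiv i).toLinearMap LinearMap.id

/-- The odd derivation of `A` given by contraction. -/
def oddDeriv (d : Module.Dual ℂ (Fin 3 ⊕ Fin 3 → ℂ)) : LAlg →ₗ[ℂ] LAlg :=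
  TensorProduct.map LinearMap.id (CliffordAlgebra.contractLeft d)

section

variable (i j : (Fin 2 ⊕ Fin 2) ⊕ (Fin 2 ⊕ Fin 2)) (d d' : Module.Dual ℂ (Fin 3 ⊕ Fin 3 → ℂ))
  (x : MvPolynomial ((Fin 2 ⊕ Fin 2) ⊕ (Fin 2 ⊕ Fin 2)) ℂ)
  (u : ExteriorAlgebra ℂ (Fin 3 ⊕ Fin 3 → ℂ)) (f g : LAlg)

lemma evenDeriv_tmul : evenDeriv i (x ⊗ₜ u) = MvPolynomial.pderiv i x ⊗ₜ u := rfl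

lemma oddDeriv_tmul : oddDeriv d (x ⊗ₜ u) = x ⊗ₜ CliffordAlgebra.contractLeft d u := rfl

lemma evenDeriv_comm : evenDeriv i (evenDeriv j f) = evenDeriv j (evenDeriv i f) := by
  induction f using TensorProduct.induction_on with
  | zero => simp only [map_zero]
  | add f g hf hg => simp only [map_add, hf, hg]
  | tmul x u => simp only [evenDeriv_tmul, MvPolynomial.pderiv_pderiv_comm i j]

lemma evenDeriv_oddDeriv_comm : evenDeriv i (oddDeriv d f) = oddDeriv d (evenDeriv i f) := by
  induction f using TensorProduct.induction_on with
  | zero => simp only [map_zero]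
  | add f g hf hg => simp only [map_add, hf, hg]
  | tmul x u => rfl

lemma oddDeriv_comm : oddDeriv d (oddDeriv d' f) = (-1 : ℂ) • oddDeriv d' (oddDeriv d f) := by
  induction f using TensorProduct.induction_on with
  | zero => simp only [map_zero, smul_zero]
  | add f g hf hg => simp only [map_add, hf, hg, smul_add]
  | tmul x u =>
    rw [oddDeriv_tmul, oddDeriv_tmul, CliffordAlgebra.contractLeft_comm, ← neg_one_smul ℂ,
      TensorProduct.tmul_smul]
    rfl

lemma alphaA_evenDeriv : alphaA (evenDeriv i f) = evenDeriv i (alphaA f) := by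
  induction f using TensorProduct.induction_on with
  | zero => simp only [map_zero]
  | add f g hf hg => simp only [map_add, hf, hg]
  | tmul x u => rfl

lemma alphaA_oddDeriv : alphaA (oddDeriv d f) = (-1 : ℂ) • oddDeriv d (alphaA f) := by
  induction f using TensorProduct.induction_on with
  | zero => simp only [map_zero, smul_zero]
  | add f g hf hg => simp only [map_add, hf, hg, smul_add]
  | tmul x u =>
    rw [oddDeriv_tmul, alphaA_tmul, involute_contractLeft, ← neg_one_smul ℂ,
      TensorProduct.tmul_smul]
    rfl

lemma evenDeriv_mul : evenDeriv i (f * g) = evenDeriv i f * g + f * evenDeriv i g := by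
  induction f using TensorProduct.induction_on with
  | zero => simp only [map_zero, zero_mul, add_zero]
  | add f f' hf hf' => simp only [map_add, add_mul, hf, hf']; abel
  | tmul x u =>
    induction g using TensorProduct.induction_on with
    | zero => simp only [map_zero, mul_zero, add_zero]
    | add g g' hg hg' => simp only [map_add, mul_add, hg, hg']; abel
    | tmul y v =>
      simp only [evenDeriv_tmul, Algebra.TensorProduct.tmul_mul_tmul, Derivation.leibniz,
        TensorProduct.add_tmul, smul_eq_mul]
      rw [add_comm, mul_comm y]

lemma oddDeriv_mul : oddDeriv d (f * g) = oddDeriv d f * g + alphaA f * oddDeriv d g := by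
  induction f using TensorProduct.induction_on with
  | zero => simp only [map_zero, zero_mul, add_zero]
  | add f f' hf hf' => simp only [map_add, add_mul, hf, hf']; abel
  | tmul x u =>
    induction g using TensorProduct.induction_on with
    | zero => simp only [map_zero, mul_zero, add_zero]
    | add g g' hg hg' => simp only [map_add, mul_add, hg, hg']; abel
    | tmul y v =>
      simp only [oddDeriv_tmul, alphaA_tmul, Algebra.TensorProduct.tmul_mul_tmul,
        contractLeft_mul, TensorProduct.tmul_add]

end

/-- The coordinates entering `π`: the even `X^α`, `Y^α̇` and the odd `ξᵢ`, `ζⁱ`. -/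
abbrev Coord := (Fin 2 ⊕ Fin 2) ⊕ (Fin 3 ⊕ Fin 3)

namespace Coord

def parity : Coord → ZMod 2 := Sum.elim (fun _ => 0) (fun _ => 1)

def deriv : Coord → LAlg →ₗ[ℂ] LAlg := Sum.elim (Sum.elim DX DY) (Sum.elim Dxi Dzeta)

/-- The coefficients of `π`, as functions of `λ` and `μ`. -/
def coeff {A : Type*} [Ring A] [Algebra ℂ A] (l m : Fin 2 → A) : Coord → Coord → A
  | .inl (.inl a), .inl (.inl b) =>
    !![0, l 0 * l 1; -(l 0 * l 1), 0] a b
  | .inl (.inl a), .inl (.inr b) => (1 / 2 : ℂ) • (![l 1, l 0] b * ![m 1, -m 0] a)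
  | .inl (.inr b), .inl (.inl a) => -((1 / 2 : ℂ) • (![l 1, l 0] b * ![m 1, -m 0] a))
  | .inl (.inr _), .inl (.inr _) => 0
  | .inl _, .inr _ => 0
  | .inr _, .inl _ => 0
  | .inr (.inl i), .inr (.inl j) => if i = j then l 0 * l 0 + l 1 * l 1 else 0
  | .inr (.inr i), .inr (.inr j) => if i = j then m 0 * m 0 + m 1 * m 1 else 0
  | .inr (.inl _), .inr (.inr _) => 0
  | .inr (.inr _), .inr (.inl _) => 0

section Generic

variable {A : Type*} [Ring A] [Algebra ℂ A] (l m : Fin 2 → A)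

lemma coeff_mem (K : Subalgebra ℂ A) (hl : ∀ α, l α ∈ K) (hm : ∀ α, m α ∈ K) (a b : Coord) :
    coeff l m a b ∈ K := by
  have hX (a b : Fin 2) : !![0, l 0 * l 1; -(l 0 * l 1), 0] a b ∈ K := by
    have := K.mul_mem (hl 0) (hl 1)
    fin_cases a <;> fin_cases b <;> simp [this]
  have hXY (a b : Fin 2) : (1 / 2 : ℂ) • (![l 1, l 0] b * ![m 1, -m 0] a) ∈ K := by
    refine K.smul_mem (K.mul_mem ?_ ?_) _
    · fin_cases b <;> simp [hl]
    · fin_cases a <;> simp [hm]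
  have hodd (n : Fin 2 → A) (hn : ∀ α, n α ∈ K) (i j : Fin 3) :
      (if i = j then n 0 * n 0 + n 1 * n 1 else 0) ∈ K := by
    split_ifs
    · exact K.add_mem (K.mul_mem (hn _) (hn _)) (K.mul_mem (hn _) (hn _))
    · exact K.zero_mem
  rcases a with (a | a) | (a | a) <;> rcases b with (b | b) | (b | b) <;>
    first
    | exact K.zero_mem
    | exact hX a b
    | exact hXY a b
    | exact K.neg_mem (hXY b a)
    | exact hodd l hl a b
    | exact hodd m hm a b

lemma coeff_swap (a b : Coord) : coeff l m a b = -(sgn (parity a) • coeff l m b a) := by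
  rcases a with (a | a) | (a | a) <;> rcases b with (b | b) | (b | b) <;>
    simp [coeff, parity, sgn_zero, sgn_one, eq_comm]
  · fin_cases a <;> fin_cases b <;> simp
  all_goals split_ifs <;> simp [add_comm]

lemma coeff_eq_zero {a b : Coord} (h : parity a ≠ parity b) : coeff l m a b = 0 := by
  rcases a with (a | a) | (a | a) <;> rcases b with (b | b) | (b | b) <;>
    first
    | rfl
    | exact absurd rfl h

lemma sum_coeff (p : ZMod 2) (X Y X' Y' : Fin 2 → A) (ξ ζ ξ' ζ' : Fin 3 → A) :
    ∑ a : Coord, ∑ b : Coord, sgn (parity a * p) • (coeff l m a b *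
      (Sum.elim (Sum.elim X Y) (Sum.elim ξ ζ) a * Sum.elim (Sum.elim X' Y') (Sum.elim ξ' ζ') b)) =
    l 0 * l 1 * (X 0 * X' 1 - X 1 * X' 0) +
      (1 / 2 : ℂ) • (l 1 * m 1 * (X 0 * Y' 0 - Y 0 * X' 0)) +
      (1 / 2 : ℂ) • (l 0 * m 1 * (X 0 * Y' 1 - Y 1 * X' 0)) -
      (1 / 2 : ℂ) • (l 1 * m 0 * (X 1 * Y' 0 - Y 0 * X' 1)) -
      (1 / 2 : ℂ) • (l 0 * m 0 * (X 1 * Y' 1 - Y 1 * X' 1)) +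
      sgn p • ((l 0 * l 0 + l 1 * l 1) * ∑ i, ξ i * ξ' i +
        (m 0 * m 0 + m 1 * m 1) * ∑ i, ζ i * ζ' i) := by
  simp only [Fintype.sum_sum_type, coeff, parity, Sum.elim_inl, Sum.elim_inr, ite_mul, zero_mul,
    one_mul, sgn_zero, one_smul, smul_zero, smul_ite, Finset.sum_ite_eq, Finset.mem_univ, if_true,
    Finset.sum_const_zero, Finset.mul_sum, Finset.smul_sum, smul_add, add_zero, zero_add]
  simp [Fin.sum_univ_two, mul_sub, smul_sub]
  abel

end Generic

lemma deriv_inl (a : Fin 2 ⊕ Fin 2) : ∃ i, deriv (.inl a) = evenDeriv i := by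
  rcases a with a | a
  · exact ⟨.inl (.inl a), rfl⟩
  · exact ⟨.inr (.inl a), rfl⟩

lemma Dxi_eq_oddDeriv (i : Fin 3) : Dxi i = oddDeriv (LinearMap.proj (.inl i)) := by
  rw [Dxi, oddDeriv]

lemma Dzeta_eq_oddDeriv (i : Fin 3) : Dzeta i = oddDeriv (LinearMap.proj (.inr i)) := by
  rw [Dzeta, oddDeriv]

lemma deriv_inr (a : Fin 3 ⊕ Fin 3) : ∃ d, deriv (.inr a) = oddDeriv d := by
  rcases a with a | a
  · exact ⟨_, Dxi_eq_oddDeriv a⟩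
  · exact ⟨_, Dzeta_eq_oddDeriv a⟩

lemma parity_inl (a : Fin 2 ⊕ Fin 2) : parity (.inl a) = 0 := rfl

lemma parity_inr (a : Fin 3 ⊕ Fin 3) : parity (.inr a) = 1 := rfl

lemma deriv_comm (a b : Coord) (f : LAlg) :
    deriv a (deriv b f) = sgn (parity a * parity b) • deriv b (deriv a f) := by
  rcases a with a | a <;> rcases b with b | b
  · obtain ⟨i, hi⟩ := deriv_inl a
    obtain ⟨j, hj⟩ := deriv_inl b
    rw [parity_inl, zero_mul, sgn_zero, one_smul, hi, hj, evenDeriv_comm]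
  · obtain ⟨i, hi⟩ := deriv_inl a
    obtain ⟨d, hd⟩ := deriv_inr b
    rw [parity_inl, zero_mul, sgn_zero, one_smul, hi, hd, evenDeriv_oddDeriv_comm]
  · obtain ⟨d, hd⟩ := deriv_inr a
    obtain ⟨j, hj⟩ := deriv_inl b
    rw [parity_inl, mul_zero, sgn_zero, one_smul, hj, hd, evenDeriv_oddDeriv_comm]
  · obtain ⟨d, hd⟩ := deriv_inr a
    obtain ⟨d', hd'⟩ := deriv_inr b
    rw [parity_inr, parity_inr, mul_one, sgn_one, hd, hd']
    exact oddDeriv_comm d d' f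

lemma deriv_isHomog (a : Coord) {p : ZMod 2} {f : LAlg} (hf : IsHomog p f) :
    IsHomog (p + parity a) (deriv a f) := by
  have key : alphaA (deriv a f) = sgn (parity a) • deriv a (alphaA f) := by
    rcases a with a | a
    · obtain ⟨i, hi⟩ := deriv_inl a
      rw [parity_inl, sgn_zero, one_smul, hi, alphaA_evenDeriv]
    · obtain ⟨d, hd⟩ := deriv_inr a
      rw [parity_inr, sgn_one, hd]
      exact alphaA_oddDeriv d f
  rw [isHomog_iff] at *
  rw [key, hf, map_smul, smul_smul, sgn_add, _root_.mul_comm]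

lemma deriv_mul (a : Coord) {p : ZMod 2} {f : LAlg} (g : LAlg) (hf : IsHomog p f) :
    deriv a (f * g) = deriv a f * g + sgn (parity a * p) • (f * deriv a g) := by
  rw [isHomog_iff] at hf
  rcases a with a | a
  · obtain ⟨i, hi⟩ := deriv_inl a
    rw [parity_inl, zero_mul, sgn_zero, one_smul, hi, evenDeriv_mul]
  · obtain ⟨d, hd⟩ := deriv_inr a
    rw [parity_inr, one_mul, hd, oddDeriv_mul, hf, smul_mul_assoc]

lemma deriv_tmul_one {x : MvPolynomial ((Fin 2 ⊕ Fin 2) ⊕ (Fin 2 ⊕ Fin 2)) ℂ}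
    (hX : ∀ α, MvPolynomial.pderiv (.inl (.inl α)) x = 0)
    (hY : ∀ α, MvPolynomial.pderiv (.inr (.inl α)) x = 0) (a : Coord) :
    deriv a (x ⊗ₜ 1) = 0 := by
  rcases a with a | a
  · rcases a with a | a
    · exact (congrArg (· ⊗ₜ 1) (hX a)).trans (TensorProduct.zero_tmul _ _)
    · exact (congrArg (· ⊗ₜ 1) (hY a)).trans (TensorProduct.zero_tmul _ _)
  · obtain ⟨d, hd⟩ := deriv_inr a
    rw [hd, oddDeriv_tmul, CliffordAlgebra.contractLeft_one, TensorProduct.tmul_zero]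

lemma isHomog_tmul_one (x : MvPolynomial ((Fin 2 ⊕ Fin 2) ⊕ (Fin 2 ⊕ Fin 2)) ℂ) :
    IsHomog 0 (x ⊗ₜ 1) := by
  rw [IsHomog, if_pos rfl, alphaA_tmul, map_one]

/-- The even elements of `A` annihilated by all the derivations entering `π`. -/
def constants : Subalgebra ℂ LAlg where
  carrier := {f | IsHomog 0 f ∧ ∀ a, deriv a f = 0}
  mul_mem' {f g} hf hg := ⟨add_zero (0 : ZMod 2) ▸ hf.1.mul hg.1, fun a => by
    rw [deriv_mul a g hf.1, hf.2, hg.2, zero_mul, mul_zero f, zero_add]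
    exact smul_zero (A := LAlg) (sgn (parity a * 0))⟩
  add_mem' hf hg := ⟨hf.1.add hg.1, fun a => by rw [map_add, hf.2, hg.2, add_zero]⟩
  algebraMap_mem' r := ⟨isHomog_tmul_one _, deriv_tmul_one
    (fun _ => MvPolynomial.pderiv_C) (fun _ => MvPolynomial.pderiv_C)⟩

lemma lam_mem_constants (α : Fin 2) : lam α ∈ constants :=
  ⟨isHomog_tmul_one _, deriv_tmul_one (fun _ => MvPolynomial.pderiv_X_of_ne (by simp))
    (fun _ => MvPolynomial.pderiv_X_of_ne (by simp))⟩

lemma mu_mem_constants (α : Fin 2) : mu α ∈ constants :=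
  ⟨isHomog_tmul_one _, deriv_tmul_one (fun _ => MvPolynomial.pderiv_X_of_ne (by simp))
    (fun _ => MvPolynomial.pderiv_X_of_ne (by simp))⟩

/-- The superbivector `π`. -/
def superbivector : SuperbivectorData LAlg Coord where
  homog p :=
    { carrier := {f | IsHomog p f}
      zero_mem' := .zero
      add_mem' := .add
      smul_mem' := fun c _ => .smul c }
  mul_mem := IsHomog.mul
  mul_comm := IsHomog.mul_comm
  ε := parity
  D := deriv
  D_mem a _ _ := deriv_isHomog a
  D_mul a _ _ g := deriv_mul a g
  D_comm := deriv_comm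
  π := coeff lam mu
  π_mem a b := (coeff_mem lam mu constants lam_mem_constants mu_mem_constants a b).1
  D_π c a b := (coeff_mem lam mu constants lam_mem_constants mu_mem_constants a b).2 c
  π_swap := coeff_swap lam mu
  π_eq_zero _ _ := coeff_eq_zero lam mu

lemma mem_homog_superbivector {p : ZMod 2} {f : LAlg} :
    f ∈ superbivector.homog p ↔ IsHomog p f := Iff.rfl

lemma deriv_apply (f : LAlg) (a : Coord) :
    deriv a f = Sum.elim (Sum.elim (fun α => DX α f) (fun α => DY α f))
      (Sum.elim (fun i => Dxi i f) (fun i => Dzeta i f)) a := by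
  rcases a with (a | a) | (a | a) <;> rfl

lemma bracket_superbivector (p : ZMod 2) (f g : LAlg) :
    superbivector.bracket p f g = ∑ a : Coord, ∑ b : Coord,
      sgn (parity a * p) • (coeff lam mu a b * (deriv a f * deriv b g)) := rfl

lemma br_eq_bracket (p : ZMod 2) (f g : LAlg) : br p f g = superbivector.bracket p f g := by
  rw [bracket_superbivector]
  simp only [deriv_apply]
  rw [sum_coeff, br, lamlam, lamSq, muSq]

end Coord

/-- The bracket determined by the superbivector `π` of the super
ambitwistor case `ℒ^{5|6}` is an even super Poisson bracket: even, super antisymmetric,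
super Leibniz, and satisfying the super Jacobi identity. -/
theorem br_superPoisson_L56 :
    (∀ (p q : ZMod 2) (f g : LAlg), IsHomog p f → IsHomog q g →
      IsHomog (p + q) (br p f g)) ∧
    (∀ (p q : ZMod 2) (f g : LAlg), IsHomog p f → IsHomog q g →
      br p f g = -(sgn (p * q)) • br q g f) ∧
    (∀ (p q : ZMod 2) (f g h : LAlg), IsHomog p f → IsHomog q g →
      br p f (g * h) = br p f g * h + sgn (p * q) • (g * br p f h)) ∧
    (∀ (p q r : ZMod 2) (f g h : LAlg), IsHomog p f → IsHomog q g → IsHomog r h →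
      sgn (p * r) • br p f (br q g h) + sgn (q * p) • br q g (br r h f) +
        sgn (r * q) • br r h (br p f g) = 0) := by
  simp only [Coord.br_eq_bracket, ← Coord.mem_homog_superbivector]
  exact ⟨fun _ _ _ _ => Coord.superbivector.bracket_mem,
    fun _ _ _ _ => Coord.superbivector.bracket_swap,
    fun _ _ _ _ h hf hg => Coord.superbivector.bracket_mul hf hg h,
    fun _ _ _ _ _ _ => Coord.superbivector.bracket_jacobi⟩

end
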